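/- A finite-valued random variable X is uniformly distributed over its support if and only if there exist random variables U1, U2 adjoinable to X such that TRIPLE(X,U1,U2) holds; moreover, in that case U1 and U2 can be chosen so that their supports have the same cardinality as the support of X. -/

import Mathlib

namespace CIPaper

/-- A bundled probability space. -/
structure ProbSpace where
  carrier : Type
  [inst : MeasurableSpace carrier]
  μ : MeasureTheory.Measure carrier
  [isProb : MeasureTheory.IsProbabilityMeasure μ]

attribute [instance] ProbSpace.inst ProbSpace.isProb

/-- A bundled finite measurable alphabet, used as value space of auxiliary random variables. -/
structure FinAlphabet where
  carrier : Type
  [fin : Fintype carrier]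
  [ms : MeasurableSpace carrier]
  [msc : MeasurableSingletonClass carrier]

attribute [instance] FinAlphabet.fin FinAlphabet.ms FinAlphabet.msc

open MeasureTheory ProbabilityTheory Real

variable {Ω : Type*} [MeasurableSpace Ω] {S T U : Type*}

/-- P(X = x). -/
noncomputable def pr (μ : Measure Ω) (X : Ω → S) (x : S) : ℝ :=
  (μ (X ⁻¹' {x})).toReal

/-- Shannon entropy (base 2) of a finite-valued random variable. -/
noncomputable def ent (μ : Measure Ω) [Fintype S] (X : Ω → S) : ℝ :=
  (∑ x, Real.negMulLog (pr μ X x)) / Real.log 2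

/-- Conditional entropy H(X|Y). -/
noncomputable def condEnt (μ : Measure Ω) [Fintype S] [Fintype T]
    (X : Ω → S) (Y : Ω → T) : ℝ :=
  ent μ (fun ω => (X ω, Y ω)) - ent μ Y

/-- Mutual information I(X;Y). -/
noncomputable def mi (μ : Measure Ω) [Fintype S] [Fintype T]
    (X : Ω → S) (Y : Ω → T) : ℝ :=
  ent μ X + ent μ Y - ent μ (fun ω => (X ω, Y ω))

/-- Conditional mutual information I(X;Y|Z). -/
noncomputable def cmi (μ : Measure Ω) [Fintype S] [Fintype T] [Fintype U]
    (X : Ω → S) (Y : Ω → T) (Z : Ω → U) : ℝ :=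
  ent μ (fun ω => (X ω, Z ω)) + ent μ (fun ω => (Y ω, Z ω))
    - ent μ (fun ω => (X ω, (Y ω, Z ω))) - ent μ Z

/-- The support of a random variable: values of positive probability. -/
def support (μ : Measure Ω) (X : Ω → S) : Set S := {x | 0 < pr μ X x}

/-- X is uniformly distributed over its support. -/
def IsUniform (μ : Measure Ω) (X : Ω → S) : Prop :=
  ∀ x ∈ support μ X, ∀ y ∈ support μ X, pr μ X x = pr μ X y

/-- X is uniformly distributed over a support of size n. -/
def UniformOn (μ : Measure Ω) (X : Ω → S) (n : ℕ) : Prop :=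
  IsUniform μ X ∧ (support μ X).ncard = n

/-- The TRIPLE predicate: pairwise independence plus each variable a function of the
other two. -/
def TRIPLE (μ : Measure Ω) [Fintype S] [Fintype T] [Fintype U]
    (X : Ω → S) (Y : Ω → T) (Z : Ω → U) : Prop :=
  condEnt μ X (fun ω => (Y ω, Z ω)) = 0 ∧ condEnt μ Y (fun ω => (X ω, Z ω)) = 0 ∧
    condEnt μ Z (fun ω => (X ω, Y ω)) = 0 ∧
    mi μ X Y = 0 ∧ mi μ X Z = 0 ∧ mi μ Y Z = 0

end CIPaper

namespace CIPaper

open MeasureTheory ProbabilityTheory Real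

section Marginals

variable {Ω : Type*} [MeasurableSpace Ω] {μ : Measure Ω}
  {S T : Type*} [Fintype S] [MeasurableSpace S] [MeasurableSingletonClass S]
  {X : Ω → S}

lemma pr_nonneg (μ : Measure Ω) (X : Ω → T) (x : T) : 0 ≤ pr μ X x :=
  ENNReal.toReal_nonneg

lemma pr_le_of_subset [IsFiniteMeasure μ] {T' : Type*} {X : Ω → T} {Y : Ω → T'} {x : T} {y : T'}
    (h : X ⁻¹' {x} ⊆ Y ⁻¹' {y}) : pr μ X x ≤ pr μ Y y :=
  ENNReal.toReal_mono (measure_ne_top _ _) (measure_mono h)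

lemma sum_pr [IsProbabilityMeasure μ] (hX : Measurable X) : ∑ x, pr μ X x = 1 := by
  have h := sum_measure_preimage_singleton (μ := μ) (f := X) Finset.univ
    (fun y _ => hX (measurableSet_singleton y))
  simp only [pr]
  rw [← ENNReal.toReal_sum (fun _ _ => measure_ne_top _ _), h]
  simp

lemma sum_pr_pair_right [IsFiniteMeasure μ] (hX : Measurable X) (Y : Ω → T) (y : T) :
    ∑ x, pr μ (fun ω => (X ω, Y ω)) (x, y) = pr μ Y y := by
  have h := sum_measure_preimage_singleton (μ := μ.restrict (Y ⁻¹' {y})) (f := X) Finset.univ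
    (fun y _ => hX (measurableSet_singleton y))
  simp only [pr]
  rw [← ENNReal.toReal_sum (fun _ _ => measure_ne_top _ _)]
  congr 1
  simp only [Finset.coe_univ, Set.preimage_univ, Measure.restrict_apply_univ] at h
  rw [← h]
  refine Finset.sum_congr rfl fun x _ => ?_
  rw [Measure.restrict_apply (hX (measurableSet_singleton x))]
  congr 1
  ext ω
  simp

lemma sum_pr_pair_left [IsFiniteMeasure μ] (hX : Measurable X) (Y : Ω → T) (y : T) :
    ∑ x, pr μ (fun ω => (Y ω, X ω)) (y, x) = pr μ Y y := by
  rw [← sum_pr_pair_right hX Y y]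
  refine Finset.sum_congr rfl fun x _ => ?_
  simp only [pr]
  congr 2
  ext ω
  simp [and_comm]

end Marginals

section ZeroInformation

variable {Ω : Type*} [MeasurableSpace Ω] {μ : Measure Ω} [IsProbabilityMeasure μ]
  {S T : Type*} [Fintype S] [MeasurableSpace S] [MeasurableSingletonClass S]
  [Fintype T] {X : Ω → S} {Y : Ω → T}

lemma log_two_ne_zero : Real.log 2 ≠ 0 := (Real.log_pos one_lt_two).ne'

lemma pr_pair_eq_of_condEnt_eq_zero (hX : Measurable X) (h : condEnt μ X Y = 0)
    {x : S} {y : T} (hxy : 0 < pr μ (fun ω => (X ω, Y ω)) (x, y)) :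
    pr μ (fun ω => (X ω, Y ω)) (x, y) = pr μ Y y := by
  set p : S × T → ℝ := pr μ (fun ω => (X ω, Y ω)) with hp
  have hle : ∀ z, p z ≤ pr μ Y z.2 := fun z =>
    pr_le_of_subset fun ω hω => by
      have h' : (X ω, Y ω) = z := hω
      simp [← h']
  have hsum : ∑ z, p z * (Real.log (pr μ Y z.2) - Real.log (p z)) = 0 := by
    rw [condEnt, ent, ent, ← sub_div, div_eq_zero_iff, or_iff_left log_two_ne_zero] at h
    rw [← h]
    have hY : ∑ y, Real.negMulLog (pr μ Y y) = -∑ z, p z * Real.log (pr μ Y z.2) := by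
      rw [Fintype.sum_prod_type_right, ← Finset.sum_neg_distrib]
      refine Finset.sum_congr rfl fun y _ => ?_
      dsimp only
      rw [← Finset.sum_mul, sum_pr_pair_right hX, Real.negMulLog, neg_mul]
    rw [hY, sub_neg_eq_add, ← Finset.sum_add_distrib]
    refine Finset.sum_congr rfl fun z _ => ?_
    rw [Real.negMulLog]
    ring
  have hnn : ∀ z ∈ Finset.univ, 0 ≤ p z * (Real.log (pr μ Y z.2) - Real.log (p z)) := by
    intro z _
    rcases (pr_nonneg μ (fun ω => (X ω, Y ω)) z).eq_or_lt with h0 | h0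
    · simp [hp, ← h0]
    · exact mul_nonneg h0.le (sub_nonneg.2 (Real.log_le_log h0 (hle z)))
  have h0 := (Finset.sum_eq_zero_iff_of_nonneg hnn).1 hsum (x, y) (Finset.mem_univ _)
  have hlog := (mul_eq_zero.1 h0).resolve_left hxy.ne'
  exact (Real.log_injOn_pos (Set.mem_Ioi.2 (hxy.trans_le (hle (x, y)))) (Set.mem_Ioi.2 hxy)
    (sub_eq_zero.1 hlog)).symm

lemma mul_log_sub_log_eq_mul_klFun {a b : ℝ} (h : b = 0 → a = 0) :
    a * (Real.log a - Real.log b) + b - a = b * InformationTheory.klFun (a / b) := by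
  rcases eq_or_ne b 0 with hb | hb
  · simp [hb, h hb]
  · rcases eq_or_ne a 0 with ha | ha
    · simp [ha, InformationTheory.klFun]
    · rw [InformationTheory.klFun, Real.log_div ha hb]
      field_simp

variable [MeasurableSpace T] [MeasurableSingletonClass T]

lemma pr_pair_eq_mul_of_mi_eq_zero (hX : Measurable X) (hY : Measurable Y) (h : mi μ X Y = 0)
    (x : S) (y : T) : pr μ (fun ω => (X ω, Y ω)) (x, y) = pr μ X x * pr μ Y y := by
  set p : S × T → ℝ := pr μ (fun ω => (X ω, Y ω)) with hp
  have hleX : ∀ z, p z ≤ pr μ X z.1 := fun z =>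
    pr_le_of_subset fun ω hω => by
      have h' : (X ω, Y ω) = z := hω
      simp [← h']
  have hleY : ∀ z, p z ≤ pr μ Y z.2 := fun z =>
    pr_le_of_subset fun ω hω => by
      have h' : (X ω, Y ω) = z := hω
      simp [← h']
  have hp0 : ∀ z, 0 ≤ p z := pr_nonneg μ _
  have hzero : ∀ z : S × T, pr μ X z.1 * pr μ Y z.2 = 0 → p z = 0 := by
    intro z hz
    rcases mul_eq_zero.1 hz with h0 | h0
    · exact le_antisymm (h0 ▸ hleX z) (hp0 z)
    · exact le_antisymm (h0 ▸ hleY z) (hp0 z)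
  have hentX : ∑ x, Real.negMulLog (pr μ X x) = -∑ z, p z * Real.log (pr μ X z.1) := by
    rw [Fintype.sum_prod_type, ← Finset.sum_neg_distrib]
    refine Finset.sum_congr rfl fun x _ => ?_
    dsimp only
    rw [← Finset.sum_mul, sum_pr_pair_left hY, Real.negMulLog, neg_mul]
  have hentY : ∑ y, Real.negMulLog (pr μ Y y) = -∑ z, p z * Real.log (pr μ Y z.2) := by
    rw [Fintype.sum_prod_type_right, ← Finset.sum_neg_distrib]
    refine Finset.sum_congr rfl fun y _ => ?_
    dsimp only
    rw [← Finset.sum_mul, sum_pr_pair_right hX, Real.negMulLog, neg_mul]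
  have hkl : ∑ z : S × T, p z * (Real.log (p z) - Real.log (pr μ X z.1 * pr μ Y z.2)) = 0 := by
    rw [mi, ent, ent, ent, ← add_div, ← sub_div, div_eq_zero_iff,
      or_iff_left log_two_ne_zero, hentX, hentY] at h
    rw [← h, ← neg_add, ← Finset.sum_add_distrib, ← Finset.sum_neg_distrib,
      ← Finset.sum_sub_distrib]
    refine Finset.sum_congr rfl fun z _ => ?_
    rw [← hp, Real.negMulLog]
    rcases eq_or_ne (p z) 0 with h0 | h0
    · simp [h0]
    · have hne := mt (hzero z) h0
      rw [Real.log_mul (left_ne_zero_of_mul hne) (right_ne_zero_of_mul hne)]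
      ring
  have hprod : ∑ z : S × T, pr μ X z.1 * pr μ Y z.2 = 1 := by
    rw [Fintype.sum_prod_type, ← Finset.sum_mul_sum, sum_pr hX, sum_pr hY, one_mul]
  have hsum : ∑ z : S × T, pr μ X z.1 * pr μ Y z.2 *
      InformationTheory.klFun (p z / (pr μ X z.1 * pr μ Y z.2)) = 0 := by
    simp_rw [← fun z => mul_log_sub_log_eq_mul_klFun (hzero z)]
    rw [Finset.sum_sub_distrib, Finset.sum_add_distrib, hkl, hprod, hp,
      sum_pr (hX.prodMk hY)]
    norm_num
  have hnn : ∀ z ∈ Finset.univ, 0 ≤ pr μ X z.1 * pr μ Y z.2 *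
      InformationTheory.klFun (p z / (pr μ X z.1 * pr μ Y z.2)) := fun z _ =>
    mul_nonneg (mul_nonneg (pr_nonneg μ X _) (pr_nonneg μ Y _))
      (InformationTheory.klFun_nonneg
        (div_nonneg (hp0 z) (mul_nonneg (pr_nonneg μ X _) (pr_nonneg μ Y _))))
  have h0 := (Finset.sum_eq_zero_iff_of_nonneg hnn).1 hsum (x, y) (Finset.mem_univ _)
  rcases eq_or_ne (pr μ X x * pr μ Y y) 0 with hb | hb
  · rw [hb, hzero (x, y) hb]
  · have hone := (InformationTheory.klFun_eq_zero_iff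
      (div_nonneg (hp0 (x, y)) (mul_nonneg (pr_nonneg μ X x) (pr_nonneg μ Y y)))).1
      ((mul_eq_zero.1 h0).resolve_left hb)
    exact (div_eq_one_iff_eq hb).1 hone

lemma exists_pr_pos (hX : Measurable X) : ∃ x, 0 < pr μ X x := by
  by_contra! hcon
  have h1 := sum_pr (μ := μ) hX
  have h2 : ∑ x, pr μ X x ≤ 0 := Finset.sum_nonpos fun x _ => hcon x
  linarith

end ZeroInformation

lemma TRIPLE.isUniform {Ω : Type*} [MeasurableSpace Ω] {μ : Measure Ω} [IsProbabilityMeasure μ]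
    {S T U : Type*} [Fintype S] [MeasurableSpace S] [MeasurableSingletonClass S]
    [Fintype T] [MeasurableSpace T] [MeasurableSingletonClass T]
    [Fintype U] [MeasurableSpace U] [MeasurableSingletonClass U]
    {X : Ω → S} {Y : Ω → T} {Z : Ω → U} (h : TRIPLE μ X Y Z)
    (hX : Measurable X) (hY : Measurable Y) (hZ : Measurable Z) : IsUniform μ X := by
  obtain ⟨hXYZ, hYXZ, -, hXY, hXZ, hYZ⟩ := h
  obtain ⟨y, hy⟩ := exists_pr_pos (μ := μ) hY
  suffices key : ∀ x ∈ support μ X, pr μ X x = pr μ Y y from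
    fun x hx x' hx' => (key x hx).trans (key x' hx').symm
  intro x hx
  have hx : 0 < pr μ X x := hx
  have hxy : 0 < pr μ (fun ω => (X ω, Y ω)) (x, y) := by
    rw [pr_pair_eq_mul_of_mi_eq_zero hX hY hXY]
    exact mul_pos hx hy
  rw [← sum_pr_pair_left hZ] at hxy
  obtain ⟨z, -, hz⟩ := Finset.exists_lt_of_sum_lt (s := Finset.univ) (f := fun _ => (0 : ℝ))
    (by simpa using hxy)
  have h1 : pr μ (fun ω => ((X ω, Y ω), Z ω)) ((x, y), z) =
      pr μ (fun ω => (X ω, (Y ω, Z ω))) (x, (y, z)) := by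
    simp only [pr]
    congr 2
    ext ω
    simp [and_assoc]
  have h2 : pr μ (fun ω => ((X ω, Y ω), Z ω)) ((x, y), z) =
      pr μ (fun ω => (Y ω, (X ω, Z ω))) (y, (x, z)) := by
    simp only [pr]
    congr 2
    ext ω
    simp [and_assoc, and_left_comm]
  have e1 := pr_pair_eq_of_condEnt_eq_zero hX hXYZ (h1 ▸ hz)
  have e2 := pr_pair_eq_of_condEnt_eq_zero hY hYXZ (h2 ▸ hz)
  rw [← h1, pr_pair_eq_mul_of_mi_eq_zero hY hZ hYZ] at e1
  rw [← h2, pr_pair_eq_mul_of_mi_eq_zero hX hZ hXZ, e1] at e2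
  have hz' : pr μ Z z ≠ 0 := by
    rintro h0
    rw [h0, mul_zero] at e1
    exact hz.ne' e1
  exact (mul_right_cancel₀ hz' e2).symm

lemma isUniform_of_identDistrib {Ω Ω' : Type*} [MeasurableSpace Ω] [MeasurableSpace Ω']
    {μ : Measure Ω} {ν : Measure Ω'} {S : Type*} [MeasurableSpace S] [MeasurableSingletonClass S]
    {X : Ω → S} {X' : Ω' → S} (h : IdentDistrib X X' μ ν) (hu : IsUniform ν X') :
    IsUniform μ X := by
  have hpr : pr μ X = pr ν X' := by
    funext x
    simp only [pr]
    rw [h.measure_mem_eq (measurableSet_singleton x)]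
  simpa only [IsUniform, support, hpr] using hu

section Construction

lemma ent_eq_log_div_log_two {Ω : Type*} [MeasurableSpace Ω] {μ : Measure Ω}
    {S : Type*} [Fintype S] {X : Ω → S} {N : ℕ}
    (hsum : ∑ x, pr μ X x = 1) (h : ∀ x, pr μ X x = 0 ∨ pr μ X x = (N : ℝ)⁻¹) :
    ent μ X = Real.log N / Real.log 2 := by
  rw [ent]
  congr 1
  calc ∑ x, Real.negMulLog (pr μ X x) = ∑ x, pr μ X x * Real.log N := by
        refine Finset.sum_congr rfl fun x _ => ?_
        rcases h x with hx | hx <;> simp [hx, Real.negMulLog]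
    _ = Real.log N := by rw [← Finset.sum_mul, hsum, one_mul]

/-- The uniform probability measure on `ZMod n × ZMod n`. -/
noncomputable def gridSpace (n : ℕ) [NeZero n] : ProbSpace :=
  letI : MeasurableSpace (ZMod n × ZMod n) := ⊤
  haveI : MeasurableSingletonClass (ZMod n × ZMod n) := ⟨fun _ => trivial⟩
  { carrier := ZMod n × ZMod n
    μ := uniformOn Set.univ
    isProb := isProbabilityMeasure_uniformOn Set.finite_univ Set.univ_nonempty }

/-- `ZMod n` as a discrete alphabet. -/
def zmodAlphabet (n : ℕ) [NeZero n] : FinAlphabet :=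
  letI : MeasurableSpace (ZMod n) := ⊤
  haveI : MeasurableSingletonClass (ZMod n) := ⟨fun _ => trivial⟩
  { carrier := ZMod n }

variable {n : ℕ} [NeZero n]

lemma measurable_gridSpace {S : Type*} [MeasurableSpace S] (f : (gridSpace n).carrier → S) :
    Measurable f := fun _ _ => trivial

lemma pr_gridSpace {S : Type*} (f : ZMod n × ZMod n → S) (x : S) :
    pr (gridSpace n).μ f x = (f ⁻¹' {x}).ncard / (n * n : ℝ) := by
  let _ : MeasurableSpace (ZMod n × ZMod n) := ⊤
  have : MeasurableSingletonClass (ZMod n × ZMod n) := ⟨fun _ => trivial⟩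
  change (uniformOn Set.univ (f ⁻¹' {x})).toReal = _
  rw [uniformOn_univ, Measure.count_apply (Set.toFinite _).measurableSet,
    ← (Set.toFinite (f ⁻¹' {x})).cast_ncard_eq]
  simp [ZMod.card, ENNReal.toReal_div, -Set.coe_ncard_eq_encard]

lemma sum_pr_gridSpace {S : Type*} [Fintype S] (f : ZMod n × ZMod n → S) :
    ∑ x, pr (gridSpace n).μ f x = 1 := by
  let _ : MeasurableSpace S := ⊤
  have : MeasurableSingletonClass S := ⟨fun _ => trivial⟩
  exact sum_pr (μ := (gridSpace n).μ) (X := f) (measurable_gridSpace f)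

lemma ent_gridSpace_of_injective {S : Type*} [Fintype S] {f : ZMod n × ZMod n → S}
    (hf : Function.Injective f) : ent (gridSpace n).μ f = 2 * (Real.log n / Real.log 2) := by
  rw [ent_eq_log_div_log_two (μ := (gridSpace n).μ) (N := n * n) (sum_pr_gridSpace f)]
  · have hn : (n : ℝ) ≠ 0 := NeZero.ne _
    push_cast
    rw [Real.log_mul hn hn]
    ring
  · intro x
    rw [pr_gridSpace f]
    have hs : (f ⁻¹' {x}).Subsingleton := Set.subsingleton_singleton.preimage hf
    rcases hs.eq_empty_or_singleton with h | ⟨a, h⟩ <;> simp [h]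

lemma pr_gridSpace_of_ncard {S : Type*} {f : ZMod n × ZMod n → S} {x : S}
    (h : (f ⁻¹' {x}).ncard = n) : pr (gridSpace n).μ f x = (n : ℝ)⁻¹ := by
  have hn : (n : ℝ) ≠ 0 := NeZero.ne _
  rw [pr_gridSpace, h]
  field_simp

lemma pr_fst {S : Type*} {e : ZMod n → S} (he : Function.Injective e) (a : ZMod n) :
    pr (gridSpace n).μ (fun ω : ZMod n × ZMod n => e ω.1) (e a) = (n : ℝ)⁻¹ := by
  refine pr_gridSpace_of_ncard ?_
  have : (fun ω : ZMod n × ZMod n => e ω.1) ⁻¹' {e a} = Set.range fun b : ZMod n => (a, b) := by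
    ext ⟨b, c⟩
    simp [he.eq_iff, eq_comm]
  rw [this, ← Set.image_univ, Set.ncard_image_of_injective _ (Prod.mk_right_injective a),
    Set.ncard_univ, Nat.card_zmod]

lemma pr_snd (a : ZMod n) :
    pr (gridSpace n).μ (fun ω : ZMod n × ZMod n => ω.2) a = (n : ℝ)⁻¹ := by
  refine pr_gridSpace_of_ncard ?_
  have : (fun ω : ZMod n × ZMod n => ω.2) ⁻¹' {a} = Set.range fun b : ZMod n => (b, a) := by
    ext ⟨b, c⟩
    simp [eq_comm]
  rw [this, ← Set.image_univ, Set.ncard_image_of_injective _ (Prod.mk_left_injective a),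
    Set.ncard_univ, Nat.card_zmod]

lemma pr_add (a : ZMod n) :
    pr (gridSpace n).μ (fun ω : ZMod n × ZMod n => ω.1 + ω.2) a = (n : ℝ)⁻¹ := by
  refine pr_gridSpace_of_ncard ?_
  have : (fun ω : ZMod n × ZMod n => ω.1 + ω.2) ⁻¹' {a} =
      Set.range fun b : ZMod n => (b, a - b) := by
    ext ⟨b, c⟩
    simp only [Set.mem_preimage, Set.mem_singleton_iff, Set.mem_range, Prod.mk.injEq,
      exists_eq_left]
    rw [sub_eq_iff_eq_add', eq_comm]
  rw [this, ← Set.image_univ,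
    Set.ncard_image_of_injective _ fun b c h => (Prod.mk.inj h).1, Set.ncard_univ, Nat.card_zmod]

lemma ent_gridSpace_of_ncard {S : Type*} [Fintype S] {f : ZMod n × ZMod n → S}
    (h : ∀ ω, pr (gridSpace n).μ f (f ω) = (n : ℝ)⁻¹) :
    ent (gridSpace n).μ f = Real.log n / Real.log 2 := by
  refine ent_eq_log_div_log_two (μ := (gridSpace n).μ) (sum_pr_gridSpace f) fun x => ?_
  by_cases hx : ∃ ω, f ω = x
  · obtain ⟨ω, rfl⟩ := hx
    exact Or.inr (h ω)
  · left
    have : f ⁻¹' {x} = ∅ := Set.eq_empty_of_forall_notMem fun ω hω => hx ⟨ω, hω⟩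
    rw [pr_gridSpace, this]
    simp

lemma triple_gridSpace {S : Type*} [Fintype S] {e : ZMod n → S} (he : Function.Injective e) :
    TRIPLE (gridSpace n).μ (fun ω : ZMod n × ZMod n => e ω.1)
      (fun ω : ZMod n × ZMod n => ω.2) (fun ω : ZMod n × ZMod n => ω.1 + ω.2) := by
  have hX := ent_gridSpace_of_ncard (f := fun ω : ZMod n × ZMod n => e ω.1)
    fun ω => pr_fst he ω.1
  have hY := ent_gridSpace_of_ncard (f := fun ω : ZMod n × ZMod n => ω.2) fun ω => pr_snd ω.2
  have hZ := ent_gridSpace_of_ncard (f := fun ω : ZMod n × ZMod n => ω.1 + ω.2)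
    fun ω => pr_add (ω.1 + ω.2)
  have hXY := ent_gridSpace_of_injective (f := fun ω : ZMod n × ZMod n => (e ω.1, ω.2))
    fun a b h => by simpa [he.eq_iff, Prod.ext_iff] using h
  have hXZ := ent_gridSpace_of_injective (f := fun ω : ZMod n × ZMod n => (e ω.1, ω.1 + ω.2))
    fun a b h => by
      simp only [Prod.mk.injEq, he.eq_iff] at h
      exact Prod.ext h.1 (by simpa [h.1] using h.2)
  have hYZ := ent_gridSpace_of_injective (f := fun ω : ZMod n × ZMod n => (ω.2, ω.1 + ω.2))
    fun a b h => by
      simp only [Prod.mk.injEq] at h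
      exact Prod.ext (by simpa [h.1] using h.2) h.1
  have hXYZ := ent_gridSpace_of_injective
    (f := fun ω : ZMod n × ZMod n => (e ω.1, (ω.2, ω.1 + ω.2)))
    fun a b h => by
      simp only [Prod.mk.injEq, he.eq_iff] at h
      exact Prod.ext h.1 h.2.1
  have hYXZ := ent_gridSpace_of_injective
    (f := fun ω : ZMod n × ZMod n => (ω.2, (e ω.1, ω.1 + ω.2)))
    fun a b h => by
      simp only [Prod.mk.injEq, he.eq_iff] at h
      exact Prod.ext h.2.1 h.1
  have hZXY := ent_gridSpace_of_injective
    (f := fun ω : ZMod n × ZMod n => (ω.1 + ω.2, (e ω.1, ω.2)))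
    fun a b h => by
      simp only [Prod.mk.injEq, he.eq_iff] at h
      exact Prod.ext h.2.1 h.2.2
  refine ⟨?_, ?_, ?_, ?_, ?_, ?_⟩
  · exact sub_eq_zero.2 (hXYZ.trans hYZ.symm)
  · exact sub_eq_zero.2 (hYXZ.trans hXZ.symm)
  · exact sub_eq_zero.2 (hZXY.trans hXY.symm)
  · exact sub_eq_zero.2 ((congrArg₂ (· + ·) hX hY).trans ((two_mul _).symm.trans hXY.symm))
  · exact sub_eq_zero.2 ((congrArg₂ (· + ·) hX hZ).trans ((two_mul _).symm.trans hXZ.symm))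
  · exact sub_eq_zero.2 ((congrArg₂ (· + ·) hY hZ).trans ((two_mul _).symm.trans hYZ.symm))

end Construction

lemma IsUniform.pr_eq_inv_ncard {Ω : Type*} [MeasurableSpace Ω] {μ : Measure Ω}
    [IsProbabilityMeasure μ] {S : Type*} [Fintype S] [MeasurableSpace S]
    [MeasurableSingletonClass S] {X : Ω → S} (hX : Measurable X) (h : IsUniform μ X) {x : S}
    (hx : x ∈ support μ X) : pr μ X x = ((support μ X).ncard : ℝ)⁻¹ := by
  classical
  have hsum := sum_pr (μ := μ) hX
  have hsupp : ∀ y, pr μ X y = if y ∈ support μ X then pr μ X x else 0 := by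
    intro y
    split_ifs with hy
    · exact h y hy x hx
    · exact le_antisymm (not_lt.1 hy) (pr_nonneg μ X y)
  rw [Finset.sum_congr rfl fun y _ => hsupp y, ← Finset.sum_filter, Finset.sum_const,
    nsmul_eq_mul] at hsum
  have hcard : (Finset.univ.filter (· ∈ support μ X)).card = (support μ X).ncard := by
    rw [← Set.ncard_coe_finset]
    simp
  rw [hcard] at hsum
  exact eq_inv_of_mul_eq_one_right hsum

lemma IsUniform.exists_triple {Ω : Type*} [MeasurableSpace Ω] {μ : Measure Ω}
    [IsProbabilityMeasure μ] {S : Type*} [Fintype S] [MeasurableSpace S]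
    [MeasurableSingletonClass S] {X : Ω → S} (hX : Measurable X) (h : IsUniform μ X) :
    ∃ (P : ProbSpace) (X' : P.carrier → S) (T₁ T₂ : FinAlphabet)
      (U₁ : P.carrier → T₁.carrier) (U₂ : P.carrier → T₂.carrier),
      Measurable X' ∧ Measurable U₁ ∧ Measurable U₂ ∧
      IdentDistrib X X' μ P.μ ∧ TRIPLE P.μ X' U₁ U₂ ∧
      (support P.μ U₁).ncard = (support P.μ X').ncard ∧
      (support P.μ U₂).ncard = (support P.μ X').ncard := by
  obtain ⟨x₀, hx₀⟩ := exists_pr_pos (μ := μ) hX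
  obtain ⟨n, hn⟩ : ∃ n, n = (support μ X).ncard := ⟨_, rfl⟩
  have hn0 : n ≠ 0 := hn ▸ ((Set.ncard_pos (Set.toFinite _)).2 ⟨x₀, hx₀⟩).ne'
  have : NeZero n := ⟨hn0⟩
  have hinv : (0 : ℝ) < (n : ℝ)⁻¹ := inv_pos.2 (Nat.cast_pos.2 (Nat.pos_of_ne_zero hn0))
  obtain ⟨φ⟩ : Nonempty (ZMod n ≃ support μ X) :=
    (Finite.card_eq).1 (by rw [Nat.card_zmod, Nat.card_coe_set_eq, hn])
  set e : ZMod n → S := fun a => φ a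
  have he : Function.Injective e := Subtype.val_injective.comp φ.injective
  have hpr : ∀ x, pr (gridSpace n).μ (fun ω : ZMod n × ZMod n => e ω.1) x = pr μ X x := by
    intro x
    by_cases hx : x ∈ support μ X
    · have hex : e (φ.symm ⟨x, hx⟩) = x := by simp [e]
      rw [h.pr_eq_inv_ncard hX hx, ← hn, ← pr_fst he (φ.symm ⟨x, hx⟩), hex]
    · have h0 : pr μ X x = 0 := le_antisymm (not_lt.1 hx) (pr_nonneg μ X x)
      have hempty : (fun ω : ZMod n × ZMod n => e ω.1) ⁻¹' {x} = ∅ :=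
        Set.eq_empty_of_forall_notMem fun ω hω => by
          have hω : e ω.1 = x := hω
          exact hx (hω ▸ (φ ω.1).2)
      rw [h0, pr_gridSpace, hempty]
      simp
  have hsX : support (gridSpace n).μ (fun ω : ZMod n × ZMod n => e ω.1) = support μ X :=
    Set.ext fun x => by simp only [support, Set.mem_ofPred_eq]; rw [hpr]
  have hcard : ∀ f : ZMod n × ZMod n → ZMod n, (∀ a, pr (gridSpace n).μ f a = (n : ℝ)⁻¹) →
      (support (gridSpace n).μ f).ncard =
        (support (gridSpace n).μ (fun ω : ZMod n × ZMod n => e ω.1)).ncard := by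
    intro f hf
    have huniv : support (gridSpace n).μ f = Set.univ :=
      Set.eq_univ_of_forall fun a => by
        change 0 < pr (gridSpace n).μ f a
        rw [hf a]
        exact hinv
    rw [hsX, huniv, Set.ncard_univ, Nat.card_zmod, hn]
  refine ⟨gridSpace n, fun ω : ZMod n × ZMod n => e ω.1, zmodAlphabet n, zmodAlphabet n,
    fun ω : ZMod n × ZMod n => ω.2, fun ω : ZMod n × ZMod n => ω.1 + ω.2,
    measurable_gridSpace _, measurable_gridSpace _, measurable_gridSpace _,
    ⟨hX.aemeasurable, (measurable_gridSpace _).aemeasurable, ?_⟩, triple_gridSpace he,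
    hcard _ pr_snd, hcard _ pr_add⟩
  refine Measure.ext_of_singleton fun x => ?_
  refine (Measure.map_apply hX (measurableSet_singleton x)).trans (Eq.trans ?_
    (Measure.map_apply (measurable_gridSpace _) (measurableSet_singleton x)).symm)
  exact ((ENNReal.toReal_eq_toReal_iff' (measure_ne_top _ _) (measure_ne_top _ _)).1 (hpr x)).symm

/-- X is uniform over its support iff random variables U₁, U₂ with
TRIPLE(X,U₁,U₂) can be adjoined; moreover they can be chosen with supports of the
same cardinality as that of X. -/
theorem stmt_1 {Ω : Type*} [MeasurableSpace Ω] (μ : Measure Ω) [IsProbabilityMeasure μ]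
    {S : Type*} [Fintype S] [MeasurableSpace S] [MeasurableSingletonClass S]
    (X : Ω → S) (hX : Measurable X) :
    (IsUniform μ X ↔
      ∃ (P : ProbSpace) (X' : P.carrier → S) (T₁ T₂ : FinAlphabet)
        (U₁ : P.carrier → T₁.carrier) (U₂ : P.carrier → T₂.carrier),
        Measurable X' ∧ Measurable U₁ ∧ Measurable U₂ ∧
        IdentDistrib X X' μ P.μ ∧ TRIPLE P.μ X' U₁ U₂) ∧
    (IsUniform μ X →
      ∃ (P : ProbSpace) (X' : P.carrier → S) (T₁ T₂ : FinAlphabet)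
        (U₁ : P.carrier → T₁.carrier) (U₂ : P.carrier → T₂.carrier),
        Measurable X' ∧ Measurable U₁ ∧ Measurable U₂ ∧
        IdentDistrib X X' μ P.μ ∧ TRIPLE P.μ X' U₁ U₂ ∧
        (support P.μ U₁).ncard = (support P.μ X').ncard ∧
        (support P.μ U₂).ncard = (support P.μ X').ncard) := by
  refine ⟨⟨fun h => ?_, ?_⟩, fun h => h.exists_triple hX⟩
  · obtain ⟨P, X', T₁, T₂, U₁, U₂, h₁, h₂, h₃, hid, ht, -⟩ := h.exists_triple hX
    exact ⟨P, X', T₁, T₂, U₁, U₂, h₁, h₂, h₃, hid, ht⟩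
  · rintro ⟨P, X', T₁, T₂, U₁, U₂, h₁, h₂, h₃, hid, ht⟩
    exact isUniform_of_identDistrib hid (ht.isUniform h₁ h₂ h₃)

end CIPaper
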